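/- Let m, n ≥ 1 with mn ≥ 2, let k ≤ min{m², n²}, and let (A_i)_{i=1}^k ⊂ M_m(ℂ) and (B_i)_{i=1}^k ⊂ M_n(ℂ) be families of Hermitian matrices, each orthonormal with respect to the Hilbert–Schmidt inner product. Set W̃ = I − Σ_{i=1}^k A_i ⊗ B_i. Then Tr(W̃) > 0, and the normalization W = W̃ / Tr(W̃) satisfies ‖W‖_F ≤ √(2/(mn − √(mn))), where ‖·‖_F is the Frobenius norm. -/

import Mathlib

open Matrix BigOperators

noncomputable section

/-- The Frobenius norm of a square complex matrix: `√(Tr(XᴴX))`. -/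
def frobeniusNorm {d : Type*} [Fintype d] (X : Matrix d d ℂ) : ℝ :=
  Real.sqrt ((Matrix.trace (Xᴴ * X)).re)

theorem Matrix.IsHermitian.trace_eq_ofReal {d : Type*} [Fintype d] {C : Matrix d d ℂ}
    (hC : C.IsHermitian) : C.trace = (C.trace.re : ℂ) := by
  have h : star C.trace = C.trace := by rw [← trace_conjTranspose, hC.eq]
  exact (Complex.conj_eq_iff_re.mp h).symm

/-- Squared Hilbert–Schmidt distance from the identity to a real combination of a
Hilbert–Schmidt orthonormal family of Hermitian matrices. -/
theorem trace_one_sub_sum_smul_sq {d ι : Type*} [Fintype d] [DecidableEq d] [Fintype ι]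
    [DecidableEq ι] (C : ι → Matrix d d ℂ) (hH : ∀ i, (C i).IsHermitian)
    (hC : ∀ i j, trace ((C i)ᴴ * C j) = if i = j then 1 else 0) (c : ι → ℝ) :
    trace ((1 - ∑ i, (c i : ℂ) • C i)ᴴ * (1 - ∑ i, (c i : ℂ) • C i))
      = ((Fintype.card d - 2 * ∑ i, c i * (C i).trace.re + ∑ i, c i ^ 2 : ℝ) : ℂ) := by
  have hS : (∑ i, (c i : ℂ) • C i)ᴴ = ∑ i, (c i : ℂ) • C i := by
    simp [conjTranspose_sum, (hH _).eq]
  have htr : trace (∑ i, (c i : ℂ) • C i) = ((∑ i, c i * (C i).trace.re : ℝ) : ℂ) := by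
    rw [trace_sum]
    push_cast
    refine Finset.sum_congr rfl fun i _ => ?_
    rw [trace_smul, smul_eq_mul, ← (hH i).trace_eq_ofReal]
  have hsq : trace ((∑ i, (c i : ℂ) • C i) * ∑ i, (c i : ℂ) • C i)
      = ((∑ i, c i ^ 2 : ℝ) : ℂ) := by
    have hC' : ∀ i j, trace (C i * C j) = if i = j then 1 else 0 := fun i j => by
      rw [← hC i j, (hH i).eq]
    simp [Finset.sum_mul, Finset.mul_sum, trace_sum, hC', sq]
  rw [conjTranspose_sub, hS, conjTranspose_one, sub_mul, mul_sub, mul_sub, one_mul, one_mul,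
    mul_one, trace_sub, trace_sub, trace_sub, htr, hsq, trace_one]
  push_cast
  ring

open scoped ComplexOrder in
/-- Bessel's inequality for the identity matrix. -/
theorem sum_trace_sq_le_card {d ι : Type*} [Fintype d] [DecidableEq d] [Fintype ι]
    [DecidableEq ι] (C : ι → Matrix d d ℂ) (hH : ∀ i, (C i).IsHermitian)
    (hC : ∀ i j, trace ((C i)ᴴ * C j) = if i = j then 1 else 0) :
    ∑ i, (C i).trace.re ^ 2 ≤ Fintype.card d := by
  have h := (posSemidef_conjTranspose_mul_self
    (1 - ∑ i, ((C i).trace.re : ℂ) • C i)).trace_nonneg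
  rw [trace_one_sub_sum_smul_sq C hH hC, Complex.zero_le_real] at h
  simp only [← sq] at h
  linarith

theorem frobeniusNorm_smul {d : Type*} [Fintype d] (c : ℂ) (X : Matrix d d ℂ) :
    frobeniusNorm (c • X) = Real.sqrt (Complex.normSq c * (trace (Xᴴ * X)).re) := by
  have h : star c * c = (Complex.normSq c : ℂ) := (Complex.normSq_eq_conj_mul_self).symm
  rw [frobeniusNorm, conjTranspose_smul, smul_mul_smul_comm, trace_smul, smul_eq_mul, h,
    Complex.re_ofReal_mul]

/-- If `(A_i)` and `(B_i)` are Hilbert–Schmidt orthonormal families of Hermitian matrices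
with `k ≤ min {m², n²}`, then `W̃ = I - Σ A_i ⊗ B_i` has positive trace and its
normalization `W = W̃ / Tr(W̃)` satisfies `‖W‖_F ≤ √(2/(mn - √(mn)))`. -/
theorem realignment_witness_frobenius_bound {m n k : ℕ} (hm : 1 ≤ m) (hn : 1 ≤ n)
    (hmn : 2 ≤ m * n) (hkmn : k ≤ min (m ^ 2) (n ^ 2))
    (A : Fin k → Matrix (Fin m) (Fin m) ℂ) (B : Fin k → Matrix (Fin n) (Fin n) ℂ)
    (hAH : ∀ i, (A i).IsHermitian) (hBH : ∀ i, (B i).IsHermitian)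
    (hA : ∀ i j, Matrix.trace ((A i)ᴴ * A j) = if i = j then 1 else 0)
    (hB : ∀ i j, Matrix.trace ((B i)ᴴ * B j) = if i = j then 1 else 0)
    (Wt : Matrix (Fin m × Fin n) (Fin m × Fin n) ℂ)
    (hWt : Wt = 1 - ∑ i, Matrix.kroneckerMap (· * ·) (A i) (B i)) :
    0 < (Matrix.trace Wt).re ∧
      frobeniusNorm ((Matrix.trace Wt)⁻¹ • Wt)
        ≤ Real.sqrt (2 / (m * n - Real.sqrt (m * n))) := by
  classical
  set C : Fin k → Matrix (Fin m × Fin n) (Fin m × Fin n) ℂ :=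
    fun i => kroneckerMap (· * ·) (A i) (B i) with hCdef
  have hCH : ∀ i, (C i).IsHermitian := fun i => by
    rw [IsHermitian, hCdef]
    exact (conjTranspose_kronecker (A i) (B i)).trans (by rw [(hAH i).eq, (hBH i).eq])
  have hC : ∀ i j, trace ((C i)ᴴ * C j) = if i = j then 1 else 0 := fun i j => by
    have h : (C i)ᴴ * C j = kroneckerMap (· * ·) ((A i)ᴴ * A j) ((B i)ᴴ * B j) := by
      rw [(hCH i).eq, (hAH i).eq, (hBH i).eq]
      exact (mul_kronecker_mul (A i) (A j) (B i) (B j)).symm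
    rw [h]
    refine (trace_kronecker _ _).trans ?_
    rw [hA, hB]
    split_ifs <;> simp
  have hCtr : ∀ i, (C i).trace.re = (A i).trace.re * (B i).trace.re := fun i => by
    have h : (C i).trace = (A i).trace * (B i).trace := trace_kronecker (A i) (B i)
    rw [h, (hAH i).trace_eq_ofReal, (hBH i).trace_eq_ofReal]
    simp
  set s : ℝ := ∑ i, (C i).trace.re with hs
  set d : ℝ := (m : ℝ) * n with hd
  have hd2 : 2 ≤ d := by rw [hd]; exact_mod_cast hmn
  have hkd : (k : ℝ) ≤ d := by
    have h : k ≤ m * n := by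
      rcases le_total m n with h | h
      · exact (hkmn.trans (min_le_left _ _)).trans (by nlinarith)
      · exact (hkmn.trans (min_le_right _ _)).trans (by nlinarith)
    rw [hd]; exact_mod_cast h
  have hsd : s ≤ √d := by
    refine Real.le_sqrt_of_sq_le ?_
    calc s ^ 2 = (∑ i, (A i).trace.re * (B i).trace.re) ^ 2 := by simp only [hs, hCtr]
      _ ≤ (∑ i, (A i).trace.re ^ 2) * ∑ i, (B i).trace.re ^ 2 :=
        Finset.sum_mul_sq_le_sq_mul_sq _ _ _
      _ ≤ d := by
        have h₁ := sum_trace_sq_le_card A hAH hA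
        have h₂ := sum_trace_sq_le_card B hBH hB
        rw [Fintype.card_fin] at h₁ h₂
        exact mul_le_mul h₁ h₂ (Finset.sum_nonneg fun _ _ => sq_nonneg _) (Nat.cast_nonneg m)
  have hsqrt : √d < d := (Real.sqrt_lt' (by linarith)).mpr (by nlinarith)
  have hpos : 0 < d - s := by linarith
  have htr : trace Wt = ((d - s : ℝ) : ℂ) := by
    rw [hWt, trace_sub, trace_sum, trace_one, Finset.sum_congr rfl fun i _ =>
      (hCH i).trace_eq_ofReal]
    simp [hs, hd]
  have hsq : (trace (Wtᴴ * Wt)).re = d - 2 * s + k := by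
    have h := trace_one_sub_sum_smul_sq C hCH hC fun _ => 1
    simp only [Complex.ofReal_one, one_smul, ← hWt, one_mul, one_pow, ← hs] at h
    rw [h, Complex.ofReal_re]
    simp [hd]
  refine ⟨by rw [htr, Complex.ofReal_re]; exact hpos, ?_⟩
  rw [frobeniusNorm_smul, hsq, htr, ← Complex.ofReal_inv, Complex.normSq_ofReal]
  refine Real.sqrt_le_sqrt ?_
  calc (d - s)⁻¹ * (d - s)⁻¹ * (d - 2 * s + k)
      ≤ (d - s)⁻¹ * (d - s)⁻¹ * (2 * (d - s)) := by gcongr; linarith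
    _ = 2 / (d - s) := by field_simp
    _ ≤ 2 / (d - √d) := by gcongr

end
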